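/- Fix cog ∈ C with cog ≤ cog*. Let V : ℤ × C → ℝ satisfy the value-bound property with constants t_s, t_max, ρ. Assume t_s < E[τ|cog,N] < E[τ|cog,H] and that E[τ|cog,N] − t_s + t_s·γ^{E[τ|cog,H]}/(1 − γ^{t_max}) ≥ γ^{t_s}·t_max/(1−ρ). Then for each a ∈ {N, H} the map q ↦ Q_V(q,cog,S) − Q_V(q,cog,a) is nondecreasing on ℤ; consequently, if Q_V(q₁,cog,S) > Q_V(q₁,cog,a) for both a ∈ {N,H} at some q₁, then the same strict inequalities hold at every q₂ ≥ q₁, i.e., there is a threshold q₂*(cog) above which action S is optimal among {S, N, H}. -/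

import Mathlib

open scoped BigOperators

namespace Fidelity

/-- The actions available to the human operator: skip, rest, normal fidelity, high fidelity. -/
inductive Action : Type
  | S | R | N | H
deriving DecidableEq

/-- Admissible action set: `{S, N, H}` for `cog ≤ cog*` and `{S, R, N, H}` for `cog > cog*`. -/
def Act {C : Type*} [LinearOrder C] (cogStar cog : C) : Finset Action :=
  if cog ≤ cogStar then {Action.S, Action.N, Action.H}
  else {Action.S, Action.R, Action.N, Action.H}

lemma Act_nonempty {C : Type*} [LinearOrder C] (cogStar cog : C) :
    (Act cogStar cog).Nonempty := by
  unfold Act; split <;> exact ⟨Action.S, by simp⟩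

/-- The reward `r(a)`: `r(H) = r_H`, `r(N) = r_N`, `r(S) = r(R) = 0`. -/
noncomputable def rew (rH rN : ℝ) : Action → ℝ
  | Action.H => rH
  | Action.N => rN
  | _ => 0

/-- Expected net immediate reward
`R((q,cog),a) = r(a) − c·E[τ|cog,a]·q − (cλ/2)·E[τ²|cog,a]`. -/
noncomputable def Rimm {C : Type*} (c lam rH rN : ℝ) (Etau Etau2 : C → Action → ℝ)
    (q : ℤ) (cog : C) (a : Action) : ℝ :=
  rew rH rN a - c * Etau cog a * (q : ℝ) - c * lam / 2 * Etau2 cog a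

/-- The Poisson probability of `w` arrivals when the mean number of arrivals is `μ`. -/
noncomputable def poissonPMF (μ : ℝ) (w : ℕ) : ℝ :=
  Real.exp (-μ) * μ ^ w / (w.factorial : ℝ)

/-- The next queue length: `q − 1 + w` under actions `S, N, H` and `q + w` under `R`. -/
def nextQ (a : Action) (q : ℤ) (w : ℕ) : ℤ :=
  if a = Action.R then q + (w : ℤ) else q - 1 + (w : ℤ)

/-- `E[γ^τ | cog, a]`, the expected discount over a sojourn in state `cog` under action `a`. -/
noncomputable def Egamma {C : Type*} [Fintype C] (γ : ℝ) (P : C → Action → ℕ → C → ℝ)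
    (cog : C) (a : Action) : ℝ :=
  ∑' (τ : ℕ), ∑' (cog' : C), γ ^ τ * P cog a τ cog'

/-- The Q-value of action `a` at `(q, cog)` for the continuation value function `V`:
`Q_V(q,cog,a) = R((q,cog),a) + Σ_{τ,cog',w} γ^τ·P(τ,cog'|cog,a)·Poisson(λτ)(w)·V(q',cog')`. -/
noncomputable def Qval {C : Type*} [Fintype C] (c lam rH rN γ : ℝ)
    (Etau Etau2 : C → Action → ℝ) (P : C → Action → ℕ → C → ℝ)
    (V : ℤ → C → ℝ) (q : ℤ) (cog : C) (a : Action) : ℝ :=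
  Rimm c lam rH rN Etau Etau2 q cog a +
    ∑' (τ : ℕ), ∑' (cog' : C), ∑' (w : ℕ),
      γ ^ τ * P cog a τ cog' * poissonPMF (lam * (τ : ℝ)) w * V (nextQ a q w) cog'

/-- `V` satisfies the value-bound property with constants `t_s`, `t_max`, `ρ`:
for all `cog'`, `q` and `Δ ∈ ℕ`,
`c·t_s·Δ/(1 − γ^{t_max}) ≤ V(q,cog') − V(q+Δ,cog') ≤ c·t_max·Δ/(1 − ρ)`. -/
def ValueBound {C : Type*} (c γ ρ : ℝ) (ts tmax : ℕ) (V : ℤ → C → ℝ) : Prop :=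
  ∀ (cog' : C) (q : ℤ) (Δ : ℕ),
    c * (ts : ℝ) * (Δ : ℝ) / (1 - γ ^ tmax) ≤ V q cog' - V (q + (Δ : ℤ)) cog' ∧
    V q cog' - V (q + (Δ : ℤ)) cog' ≤ c * (tmax : ℝ) * (Δ : ℝ) / (1 - ρ)

/-- The Poisson probabilities sum to one. -/
lemma hasSum_poissonPMF (μ : ℝ) : HasSum (poissonPMF μ) 1 := by
  have h := (NormedSpace.expSeries_div_hasSum_exp (𝔸 := ℝ) μ).mul_left (Real.exp (-μ))
  rw [← Real.exp_eq_exp_ℝ, ← Real.exp_add, neg_add_cancel, Real.exp_zero] at h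
  refine h.congr_fun fun w => ?_
  simp only [poissonPMF, mul_div_assoc]

/-- The Poisson distribution with parameter `μ` has mean `μ`. -/
lemma hasSum_poissonPMF_mul (μ : ℝ) : HasSum (fun w : ℕ => poissonPMF μ w * w) μ := by
  rw [← hasSum_nat_add_iff' 1]
  have h := (hasSum_poissonPMF μ).mul_left μ
  simp only [Finset.range_one, Finset.sum_singleton, Nat.cast_zero, mul_zero, sub_zero]
  rw [mul_one] at h
  refine h.congr_fun fun w => ?_
  have hw : ((w : ℝ) + 1) ≠ 0 := by positivity
  have hf : (w.factorial : ℝ) ≠ 0 := by positivity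
  simp only [poissonPMF, Nat.factorial_succ]
  push_cast
  field_simp
  ring

lemma poissonPMF_nonneg {μ : ℝ} (hμ : 0 ≤ μ) (w : ℕ) : 0 ≤ poissonPMF μ w := by
  unfold poissonPMF; positivity

section LinearGrowth

variable {μ K : ℝ} {f : ℤ → ℝ}

lemma abs_poissonPMF_mul_le (hμ : 0 ≤ μ) (hK : ∀ (q : ℤ) (n : ℕ), |f q - f (q + n)| ≤ K * n)
    (q : ℤ) (w : ℕ) :
    |poissonPMF μ w * f (q + w)| ≤ |f q| * poissonPMF μ w + K * (poissonPMF μ w * w) := by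
  rw [abs_mul, abs_of_nonneg (poissonPMF_nonneg hμ w)]
  have h1 : |f (q + w)| ≤ |f q| + K * w := by
    have h2 := hK q w
    have h3 := abs_sub_abs_le_abs_sub (f (q + w)) (f q)
    rw [abs_sub_comm] at h3
    linarith
  nlinarith [mul_le_mul_of_nonneg_left h1 (poissonPMF_nonneg hμ w)]

lemma hasSum_poissonPMF_bound (μ A K : ℝ) :
    HasSum (fun w : ℕ => A * poissonPMF μ w + K * (poissonPMF μ w * w)) (A + K * μ) := by
  simpa using ((hasSum_poissonPMF μ).mul_left A).add ((hasSum_poissonPMF_mul μ).mul_left K)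

lemma summable_poissonPMF_mul (hμ : 0 ≤ μ)
    (hK : ∀ (q : ℤ) (n : ℕ), |f q - f (q + n)| ≤ K * n) (q : ℤ) :
    Summable fun w : ℕ => poissonPMF μ w * f (q + w) :=
  Summable.of_norm_bounded (hasSum_poissonPMF_bound μ |f q| K).summable
    fun w => abs_poissonPMF_mul_le hμ hK q w

lemma abs_tsum_poissonPMF_mul_le (hμ : 0 ≤ μ)
    (hK : ∀ (q : ℤ) (n : ℕ), |f q - f (q + n)| ≤ K * n) (q : ℤ) :
    |∑' w : ℕ, poissonPMF μ w * f (q + w)| ≤ |f q| + K * μ :=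
  tsum_of_norm_bounded (f := fun w : ℕ => poissonPMF μ w * f (q + w))
    (hasSum_poissonPMF_bound μ |f q| K) fun w => abs_poissonPMF_mul_le hμ hK q w

lemma tsum_poissonPMF_mul_sub_mem_Icc (hμ : 0 ≤ μ)
    (hK : ∀ (q : ℤ) (n : ℕ), |f q - f (q + n)| ≤ K * n) {n : ℕ} {L U : ℝ}
    (hf : ∀ q : ℤ, f q - f (q + n) ∈ Set.Icc L U) (q : ℤ) :
    (∑' w : ℕ, poissonPMF μ w * f (q + w)) - ∑' w : ℕ, poissonPMF μ w * f (q + n + w) ∈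
      Set.Icc L U := by
  have hd := (summable_poissonPMF_mul hμ hK q).hasSum.sub
    (summable_poissonPMF_mul hμ hK (q + n)).hasSum
  have hterm : ∀ w : ℕ, f (q + w) - f (q + n + w) ∈ Set.Icc L U := fun w => by
    rw [add_right_comm q]
    exact hf _
  have hL := (hasSum_poissonPMF μ).mul_left L
  have hU := (hasSum_poissonPMF μ).mul_left U
  rw [mul_one] at hL hU
  refine ⟨hasSum_le (fun w => ?_) hL hd, hasSum_le (fun w => ?_) hd hU⟩
  · nlinarith [mul_le_mul_of_nonneg_left (hterm w).1 (poissonPMF_nonneg hμ w)]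
  · nlinarith [mul_le_mul_of_nonneg_left (hterm w).2 (poissonPMF_nonneg hμ w)]

end LinearGrowth

lemma ValueBound.abs_sub_le {C : Type*} {c γ ρ : ℝ} {ts tmax : ℕ} {V : ℤ → C → ℝ}
    (hV : ValueBound c γ ρ ts tmax V) (hc : 0 < c) (hγ : γ ∈ Set.Ioo (0 : ℝ) 1) (cog : C)
    (q : ℤ) (n : ℕ) : |V q cog - V (q + n) cog| ≤ c * tmax / (1 - ρ) * n := by
  obtain ⟨h1, h2⟩ := hV cog q n
  have h3 : 0 ≤ 1 - γ ^ tmax := sub_nonneg.2 (pow_le_one₀ hγ.1.le hγ.2.le)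
  rw [abs_of_nonneg (le_trans (by positivity) h1)]
  exact h2.trans_eq (by ring)

/-- The part of the continuation value contributed by the sojourn time `τ`. -/
noncomputable def sojournValue {C : Type*} [Fintype C] (lam γ : ℝ) (p : ℕ → C → ℝ)
    (V : ℤ → C → ℝ) (q : ℤ) (τ : ℕ) : ℝ :=
  γ ^ τ * ∑ cog' : C, p τ cog' * ∑' w : ℕ, poissonPMF (lam * τ) w * V (q + w) cog'

section Sojourn

variable {C : Type*} [Fintype C] {lam γ K : ℝ} {p : ℕ → C → ℝ} {V : ℤ → C → ℝ}

lemma Qval_eq_sojournValue (c lam rH rN γ : ℝ) (Etau Etau2 : C → Action → ℝ)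
    (P : C → Action → ℕ → C → ℝ) (V : ℤ → C → ℝ) (q : ℤ) (cog : C) {a : Action}
    (ha : a ≠ Action.R) :
    Qval c lam rH rN γ Etau Etau2 P V q cog a =
      Rimm c lam rH rN Etau Etau2 q cog a + ∑' τ, sojournValue lam γ (P cog a) V (q - 1) τ := by
  simp only [Qval, sojournValue, nextQ, if_neg ha, tsum_fintype, Finset.mul_sum, mul_assoc,
    tsum_mul_left]

lemma summable_sojournValue (hlam : 0 ≤ lam) (hγ : γ ∈ Set.Ioo (0 : ℝ) 1)
    (hp : ∀ τ cog, 0 ≤ p τ cog)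
    (hs0 : Summable fun τ => ∑ cog, p τ cog) (hs1 : Summable fun τ : ℕ => (τ : ℝ) * ∑ cog, p τ cog)
    (hK : ∀ cog (q : ℤ) (n : ℕ), |V q cog - V (q + n) cog| ≤ K * n) (q : ℤ) :
    Summable (sojournValue lam γ p V q) := by
  refine Summable.of_norm_bounded
    ((hs0.mul_left (∑ cog, |V q cog|)).add (hs1.mul_left (K * lam))) fun τ => ?_
  rw [Real.norm_eq_abs, sojournValue, abs_mul, abs_of_nonneg (pow_nonneg hγ.1.le τ)]
  refine (mul_le_of_le_one_left (abs_nonneg _) (pow_le_one₀ hγ.1.le hγ.2.le)).trans ?_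
  refine (Finset.abs_sum_le_sum_abs _ _).trans ?_
  have hM : ∀ cog, |V q cog| ≤ ∑ cog, |V q cog| := fun cog =>
    Finset.single_le_sum (f := fun cog => |V q cog|) (fun _ _ => abs_nonneg _)
      (Finset.mem_univ cog)
  calc _ ≤ ∑ cog, p τ cog * ((∑ cog, |V q cog|) + K * (lam * τ)) := by
        refine Finset.sum_le_sum fun cog _ => ?_
        rw [abs_mul, abs_of_nonneg (hp τ cog)]
        refine mul_le_mul_of_nonneg_left ?_ (hp τ cog)
        refine (abs_tsum_poissonPMF_mul_le (f := fun q => V q cog) (by positivity) (hK cog)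
          q).trans ?_
        linarith [hM cog]
    _ = _ := by rw [← Finset.sum_mul]; ring

lemma sojournValue_sub_mem_Icc (hlam : 0 ≤ lam) (hγ : 0 ≤ γ) (hp : ∀ τ cog, 0 ≤ p τ cog)
    (hK : ∀ cog (q : ℤ) (n : ℕ), |V q cog - V (q + n) cog| ≤ K * n) {n : ℕ} {L U : ℝ}
    (hV : ∀ cog (q : ℤ), V q cog - V (q + n) cog ∈ Set.Icc L U) (q : ℤ) (τ : ℕ) :
    sojournValue lam γ p V q τ - sojournValue lam γ p V (q + n) τ ∈
      Set.Icc (γ ^ τ * (∑ cog, p τ cog) * L) (γ ^ τ * (∑ cog, p τ cog) * U) := by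
  have h := fun cog => tsum_poissonPMF_mul_sub_mem_Icc (μ := lam * τ) (f := fun q => V q cog)
    (by positivity) (hK cog) (hV cog) q
  have hτ := pow_nonneg hγ τ
  simp only [sojournValue]
  rw [← mul_sub, ← Finset.sum_sub_distrib, mul_assoc, mul_assoc, Finset.sum_mul, Finset.sum_mul]
  simp only [← mul_sub]
  exact ⟨mul_le_mul_of_nonneg_left (Finset.sum_le_sum fun cog _ =>
      mul_le_mul_of_nonneg_left (h cog).1 (hp τ cog)) hτ,
    mul_le_mul_of_nonneg_left (Finset.sum_le_sum fun cog _ =>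
      mul_le_mul_of_nonneg_left (h cog).2 (hp τ cog)) hτ⟩

lemma tsum_sojournValue_sub_mem_Icc (hlam : 0 ≤ lam) (hγ : γ ∈ Set.Ioo (0 : ℝ) 1)
    (hp : ∀ τ cog, 0 ≤ p τ cog)
    (hs0 : Summable fun τ => ∑ cog, p τ cog) (hs1 : Summable fun τ : ℕ => (τ : ℝ) * ∑ cog, p τ cog)
    (hK : ∀ cog (q : ℤ) (n : ℕ), |V q cog - V (q + n) cog| ≤ K * n) {n : ℕ} {L U G : ℝ}
    (hV : ∀ cog (q : ℤ), V q cog - V (q + n) cog ∈ Set.Icc L U)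
    (hG : HasSum (fun τ => γ ^ τ * ∑ cog, p τ cog) G) (q : ℤ) :
    (∑' τ, sojournValue lam γ p V q τ) - ∑' τ, sojournValue lam γ p V (q + n) τ ∈
      Set.Icc (G * L) (G * U) := by
  have hd := (summable_sojournValue hlam hγ hp hs0 hs1 hK q).hasSum.sub
    (summable_sojournValue hlam hγ hp hs0 hs1 hK (q + n)).hasSum
  have h := sojournValue_sub_mem_Icc hlam hγ.1.le hp hK hV q
  exact ⟨hasSum_le (fun τ => (h τ).1) (hG.mul_right L) hd,
    hasSum_le (fun τ => (h τ).2) hd (hG.mul_right U)⟩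

end Sojourn

/-- Jensen's inequality `γ ^ E[τ] ≤ E[γ ^ τ]`. -/
lemma rpow_mean_le {γ E G : ℝ} (hγ : 0 < γ) {m : ℕ → ℝ} (hm : ∀ τ, 0 ≤ m τ) (h0 : HasSum m 1)
    (h1 : HasSum (fun τ : ℕ => (τ : ℝ) * m τ) E) (hG : HasSum (fun τ => γ ^ τ * m τ) G) :
    γ ^ E ≤ G := by
  have h := (h0.mul_left (γ ^ E * (1 - Real.log γ * E))).add
    (h1.mul_left (γ ^ E * Real.log γ))
  have htan : ∀ τ : ℕ, γ ^ E * (1 - Real.log γ * E) + γ ^ E * Real.log γ * τ ≤ γ ^ τ := by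
    intro τ
    have h2 : γ ^ τ = γ ^ E * Real.exp (Real.log γ * (τ - E)) := by
      rw [← Real.rpow_def_of_pos hγ, ← Real.rpow_add hγ, add_sub_cancel, Real.rpow_natCast]
    rw [h2]
    have h3 := mul_le_mul_of_nonneg_left (Real.add_one_le_exp (Real.log γ * (τ - E)))
      (Real.rpow_nonneg hγ.le E)
    linarith
  refine le_trans (le_of_eq ?_) (hasSum_le (fun τ => ?_) h hG)
  · ring
  · nlinarith [mul_le_mul_of_nonneg_right (htan τ) (hm τ)]

/-- for `cog ≤ cog*`, if `V` satisfies the value-bound property,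
`t_s < E[τ|cog,N] < E[τ|cog,H]`, and
`E[τ|cog,N] − t_s + t_s·γ^{E[τ|cog,H]}/(1−γ^{t_max}) ≥ γ^{t_s}·t_max/(1−ρ)`,
then for each `a ∈ {N,H}` the map `q ↦ Q_V(q,cog,S) − Q_V(q,cog,a)` is nondecreasing;
consequently once `S` strictly dominates both `N` and `H` it does so for all larger
queue lengths. -/
theorem stmt10 {C : Type*} [LinearOrder C] [Fintype C]
    (cogStar : C) (c lam rH rN γ : ℝ) (ts : ℕ)
    (Etau Etau2 : C → Action → ℝ) (P : C → Action → ℕ → C → ℝ)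
    (hc : 0 < c) (hlam : 0 < lam) (hγ : γ ∈ Set.Ioo (0 : ℝ) 1)
    (hrN : 0 ≤ rN) (hrHN : rN < rH) (hts : 1 ≤ ts)
    (hPnn : ∀ cog a τ cog', 0 ≤ P cog a τ cog')
    (hP0 : ∀ cog a cog', P cog a 0 cog' = 0)
    (hPsum : ∀ cog, ∀ a ∈ Act cogStar cog, (∑' (τ : ℕ), ∑' (cog' : C), P cog a τ cog') = 1)
    (hPS : ∀ cog τ cog', τ ≠ ts → P cog Action.S τ cog' = 0)
    (hEtau : ∀ cog a, Etau cog a = ∑' (τ : ℕ), ∑' (cog' : C), (τ : ℝ) * P cog a τ cog')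
    (hEtau2 : ∀ cog a, Etau2 cog a = ∑' (τ : ℕ), ∑' (cog' : C), (τ : ℝ) ^ 2 * P cog a τ cog')
    (hMom2 : ∀ cog a, Summable fun τ : ℕ => (τ : ℝ) ^ 2 * ∑' (cog' : C), P cog a τ cog')
    (tmax : ℕ) (htmax : 1 ≤ tmax) (ρ : ℝ) (hρ : ρ ∈ Set.Ioo (0 : ℝ) 1)
    (hEle : ∀ cog, ∀ a ∈ Act cogStar cog, Etau cog a ≤ (tmax : ℝ))
    (cog : C) (hcog : cog ≤ cogStar)
    (V : ℤ → C → ℝ) (hV : ValueBound c γ ρ ts tmax V)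
    (hord : (ts : ℝ) < Etau cog Action.N ∧ Etau cog Action.N < Etau cog Action.H)
    (hcond : Etau cog Action.N - (ts : ℝ)
          + (ts : ℝ) * γ ^ Etau cog Action.H / (1 - γ ^ tmax)
        ≥ γ ^ ts * ((tmax : ℝ) / (1 - ρ))) :
    (∀ a ∈ ({Action.N, Action.H} : Set Action),
      Monotone (fun q : ℤ => Qval c lam rH rN γ Etau Etau2 P V q cog Action.S - Qval c lam rH rN γ Etau Etau2 P V q cog a)) ∧
    ∀ q₁ q₂ : ℤ, q₁ ≤ q₂ →
      (∀ a ∈ ({Action.N, Action.H} : Set Action),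
        Qval c lam rH rN γ Etau Etau2 P V q₁ cog a < Qval c lam rH rN γ Etau Etau2 P V q₁ cog Action.S) →
      (∀ a ∈ ({Action.N, Action.H} : Set Action),
        Qval c lam rH rN γ Etau Etau2 P V q₂ cog a < Qval c lam rH rN γ Etau Etau2 P V q₂ cog Action.S) := by
  have hγt : 0 < 1 - γ ^ tmax := sub_pos.2 (pow_lt_one₀ hγ.1.le hγ.2 (by lia))
  have hK := hV.abs_sub_le hc hγ
  simp only [tsum_fintype] at hPsum hEtau hMom2
  have hm : ∀ a τ, 0 ≤ ∑ cog', P cog a τ cog' := fun a τ =>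
    Finset.sum_nonneg fun cog' _ => hPnn cog a τ cog'
  have hs0 : ∀ a, Summable fun τ => ∑ cog', P cog a τ cog' := fun a =>
    (hMom2 cog a).of_nonneg_of_le (hm a) fun τ => by
      rcases Nat.eq_zero_or_pos τ with rfl | hτ
      · simp [hP0]
      · have : (1 : ℝ) ≤ τ := by exact_mod_cast hτ
        exact le_mul_of_one_le_left (hm a τ) (one_le_pow₀ this)
  have hs1 : ∀ a, Summable fun τ : ℕ => (τ : ℝ) * ∑ cog', P cog a τ cog' := fun a =>
    (hMom2 cog a).of_nonneg_of_le (fun τ => mul_nonneg τ.cast_nonneg (hm a τ)) fun τ =>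
      mul_le_mul_of_nonneg_right (by exact_mod_cast Nat.le_self_pow two_ne_zero τ) (hm a τ)
  have hsG : ∀ a, Summable fun τ => γ ^ τ * ∑ cog', P cog a τ cog' := fun a =>
    (hs0 a).of_nonneg_of_le (fun τ => mul_nonneg (pow_nonneg hγ.1.le τ) (hm a τ)) fun τ =>
      mul_le_of_le_one_left (hm a τ) (pow_le_one₀ hγ.1.le hγ.2.le)
  have hE : ∀ a, HasSum (fun τ : ℕ => (τ : ℝ) * ∑ cog', P cog a τ cog') (Etau cog a) := by
    intro a
    rw [hEtau]
    simp only [← Finset.mul_sum]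
    exact (hs1 a).hasSum
  have h1 : ∀ a ∈ Act cogStar cog, HasSum (fun τ => ∑ cog', P cog a τ cog') 1 := fun a ha =>
    hPsum cog a ha ▸ (hs0 a).hasSum
  have hmem : ∀ a, a ≠ Action.R → a ∈ Act cogStar cog := by
    intro a ha
    cases a <;> simp_all [Act]
  have hS0 : ∀ τ, τ ≠ ts → ∑ cog', P cog Action.S τ cog' = 0 := fun τ hτ =>
    Finset.sum_eq_zero fun cog' _ => hPS cog τ cog' hτ
  have hS1 : ∑ cog', P cog Action.S ts cog' = 1 :=
    (hasSum_single ts hS0).unique (h1 _ (hmem _ (by simp)))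
  have hSE : Etau cog Action.S = ts := by
    refine (hE Action.S).unique ?_
    convert hasSum_single ts fun τ hτ => ?_ using 1
    · rw [hS1, mul_one]
    · rw [hS0 τ hτ, mul_zero]
  have hSG : HasSum (fun τ => γ ^ τ * ∑ cog', P cog Action.S τ cog') (γ ^ ts) := by
    convert hasSum_single ts fun τ hτ => ?_ using 1
    · rw [hS1, mul_one]
    · rw [hS0 τ hτ, mul_zero]
  have hdiff := fun (a : Action) (n : ℕ) (q : ℤ) G hG =>
    tsum_sojournValue_sub_mem_Icc (G := G) (q := q - 1) hlam.le hγ (hPnn cog a) (hs0 a) (hs1 a) hK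
      (fun cog' q => Set.mem_Icc.2 (hV cog' q n)) hG
  have hmono : ∀ a ∈ ({Action.N, Action.H} : Set Action),
      Monotone (fun q : ℤ => Qval c lam rH rN γ Etau Etau2 P V q cog Action.S -
        Qval c lam rH rN γ Etau Etau2 P V q cog a) := by
    intro a ha q₁ q₂ hq
    obtain ⟨n, rfl⟩ := Int.le.dest hq
    have haR : a ≠ Action.R := by rintro rfl; simp at ha
    have hEa : Etau cog Action.N ≤ Etau cog a ∧ Etau cog a ≤ Etau cog Action.H := by
      rcases ha with rfl | rfl
      · exact ⟨le_rfl, hord.2.le⟩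
      · exact ⟨hord.2.le, le_rfl⟩
    have hJ : γ ^ Etau cog Action.H ≤ ∑' τ, γ ^ τ * ∑ cog', P cog a τ cog' :=
      (Real.rpow_le_rpow_of_exponent_ge hγ.1 hγ.2.le hEa.2).trans
        (rpow_mean_le hγ.1 (hm a) (h1 a (hmem a haR)) (hE a) (hsG a).hasSum)
    have hUS := (hdiff Action.S n q₁ _ hSG).2
    have hLa := (hdiff a n q₁ _ (hsG a).hasSum).1
    have hLa' := (mul_le_mul_of_nonneg_right hJ
      (by positivity : 0 ≤ c * (ts : ℝ) * (n : ℝ) / (1 - γ ^ tmax))).trans hLa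
    have hcn : 0 ≤ c * (n : ℝ) := by positivity
    have hmain := mul_le_mul_of_nonneg_left hcond hcn
    have hEn := mul_le_mul_of_nonneg_left hEa.1 hcn
    have hq' : q₁ - 1 + n = q₁ + n - 1 := by ring
    rw [hq'] at hUS hLa'
    simp only [Qval_eq_sojournValue c lam rH rN γ Etau Etau2 P V _ cog haR,
      Qval_eq_sojournValue c lam rH rN γ Etau Etau2 P V _ cog (by simp : Action.S ≠ Action.R),
      Rimm, hSE]
    push_cast
    have e1 : c * n * (Etau cog Action.N - ts + ts * γ ^ Etau cog Action.H / (1 - γ ^ tmax)) =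
        c * n * Etau cog Action.N - c * n * ts +
          γ ^ Etau cog Action.H * (c * ts * n / (1 - γ ^ tmax)) := by ring
    have e2 : c * n * (γ ^ ts * (tmax / (1 - ρ))) = γ ^ ts * (c * tmax * n / (1 - ρ)) := by ring
    rw [e1, e2] at hmain
    linarith
  refine ⟨hmono, fun q₁ q₂ hq h a ha => ?_⟩
  have h2 := hmono a ha hq
  have h3 := h a ha
  simp only at h2
  linarith

end Fidelity
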